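/- Under the same setting as the previous lemma (L = ℋ(x) rank-r, μ-incoherent with condition number κ; s α-sparse with α ≤ c/(μ c_s r κ)² for a small absolute constant c; z = x + s; τ = 4αμ c_s r κ; β = μ c_s r/(2κn); appropriate γ ∈ (1/√12, 1); L_k rank-r and 4μκ²-incoherent with ‖L − L_k‖₂ ≤ 2τγ^kσ_r and ‖x − x_k‖_∞ ≤ ((τ − 2τ²)/(8ακn))γ^kσ_r; ζ_{k+1} = βγ^kσ₁(L_k); s_{k+1} = T_{ζ_{k+1}}(z − x_k); L_{k+1} = D_r(P_{T_k}ℋ(z − s_{k+1}))), the new iterate L_{k+1} is 4μκ²-incoherent; in particular its SVD factors satisfy ‖U_{k+1}‖_{2,∞} ≤ 2κ√(μ c_s r/n) and ‖V_{k+1}‖_{2,∞} ≤ 2κ√(μ c_s r/n). -/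

import Mathlib

open Matrix
open scoped BigOperators

noncomputable section

namespace ASAP

/-- The Hankel operator `ℋ : ℂⁿ → ℂ^{n₁×n₂}`, `[ℋ(x)]_{i,j} = x_{i+j}`. -/
def hankel {n₁ n₂ n : ℕ} (hn : n + 1 = n₁ + n₂) (x : Fin n → ℂ) :
    Matrix (Fin n₁) (Fin n₂) ℂ :=
  Matrix.of fun i j => x ⟨i.1 + j.1, by have hi := i.2; have hj := j.2; omega⟩

open Classical in
/-- The left inverse `ℋ†` of the Hankel operator: averages over antidiagonals. -/
def hankelDagger {n₁ n₂ n : ℕ} (_hn : n + 1 = n₁ + n₂)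
    (M : Matrix (Fin n₁) (Fin n₂) ℂ) : Fin n → ℂ := fun t =>
  (((Finset.univ.filter fun p : Fin n₁ × Fin n₂ => p.1.1 + p.2.1 = t.1).card : ℂ))⁻¹ *
    ∑ p ∈ Finset.univ.filter fun p : Fin n₁ × Fin n₂ => p.1.1 + p.2.1 = t.1, M p.1 p.2

/-- Spectral norm (largest singular value) of a matrix. -/
def specNorm {m n : Type*} [Fintype m] [Fintype n] [DecidableEq n]
    (M : Matrix m n ℂ) : ℝ :=
  ‖LinearMap.toContinuousLinearMap (Matrix.toEuclideanLin M)‖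

/-- Frobenius norm of a matrix. -/
def frobNorm {m n : Type*} [Fintype m] [Fintype n] (M : Matrix m n ℂ) : ℝ :=
  Real.sqrt (∑ i, ∑ j, ‖M i j‖ ^ 2)

/-- `‖·‖_{2,∞}`: maximum ℓ₂ norm of the rows of a matrix. -/
def rowNorm {m n : Type*} [Fintype m] [Fintype n] (M : Matrix m n ℂ) : ℝ :=
  ⨆ i, Real.sqrt (∑ j, ‖M i j‖ ^ 2)

/-- Entrywise max norm of a matrix. -/
def maxNorm {m n : Type*} [Fintype m] [Fintype n] (M : Matrix m n ℂ) : ℝ :=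
  ⨆ i, ⨆ j, ‖M i j‖

/-- ℓ∞ norm of a vector. -/
def vecMaxNorm {n : Type*} [Fintype n] (v : n → ℂ) : ℝ :=
  ⨆ t, ‖v t‖

/-- ℓ₂ norm of a vector. -/
def vecTwoNorm {n : Type*} [Fintype n] (v : n → ℂ) : ℝ :=
  Real.sqrt (∑ t, ‖v t‖ ^ 2)

/-- The augmented Hermitian matrix `[[0, M], [Mᴴ, 0]]`. -/
def aug {m n : Type*} (M : Matrix m n ℂ) : Matrix (m ⊕ n) (m ⊕ n) ℂ :=
  Matrix.fromBlocks 0 M Mᴴ 0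

open Classical in
/-- Support (set of indices of nonzero entries) of a vector. -/
def supp {n : Type*} [Fintype n] (v : n → ℂ) : Finset n :=
  Finset.univ.filter fun t => v t ≠ 0

/-- `α`-sparsity: at most `α·n` nonzero entries. -/
def IsSparse {n : ℕ} (α : ℝ) (s : Fin n → ℂ) : Prop :=
  ((supp s).card : ℝ) ≤ α * n

/-- The hard thresholding operator `T_ζ`. -/
def hardThreshold {n : ℕ} (ζ : ℝ) (v : Fin n → ℂ) : Fin n → ℂ := fun t =>
  if ζ < ‖v t‖ then v t else 0

/-- `c_s = max {n/n₁, n/n₂}`. -/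
def csConst (n₁ n₂ n : ℕ) : ℝ :=
  max ((n : ℝ) / n₁) ((n : ℝ) / n₂)

/-- `(U, σ, V)` is a (compact, rank-`r`, positive and ordered) singular value
decomposition of `L`, i.e. `L = U Σ V*` with orthonormal columns. -/
def IsSVD {m n : Type*} [Fintype m] [Fintype n] {r : ℕ}
    (L : Matrix m n ℂ) (U : Matrix m (Fin r) ℂ) (σ : Fin r → ℝ)
    (V : Matrix n (Fin r) ℂ) : Prop :=
  Uᴴ * U = 1 ∧ Vᴴ * V = 1 ∧ (∀ i, 0 < σ i) ∧ (∀ i j : Fin r, i ≤ j → σ j ≤ σ i) ∧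
    L = U * Matrix.diagonal (fun i => (σ i : ℂ)) * Vᴴ

/-- `μ`-incoherence of a rank-`r` matrix (with respect to `c_s` and `n`). -/
def IsIncoherent {m n' : Type*} [Fintype m] [Fintype n'] (r n : ℕ) (μ cs : ℝ)
    (L : Matrix m n' ℂ) : Prop :=
  ∃ (U : Matrix m (Fin r) ℂ) (σ : Fin r → ℝ) (V : Matrix n' (Fin r) ℂ),
    IsSVD L U σ V ∧ rowNorm U ≤ Real.sqrt (μ * cs * r / n) ∧
      rowNorm V ≤ Real.sqrt (μ * cs * r / n)

/-- Orthogonal projection onto the tangent space determined by `U` and `V`: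
`P_T M = UU*M + MVV* − UU*MVV*`. -/
def tangentProj {m n : Type*} [Fintype m] [Fintype n] {r : ℕ}
    (U : Matrix m (Fin r) ℂ) (V : Matrix n (Fin r) ℂ)
    (M : Matrix m n ℂ) : Matrix m n ℂ :=
  U * Uᴴ * M + M * (V * Vᴴ) - U * Uᴴ * M * (V * Vᴴ)

/-- `L` is a best rank-`r` approximation of `A` with respect to the norm `nrm`. -/
def IsBestApproxWrt {m n : Type*} [Fintype m] [Fintype n] (r : ℕ)
    (nrm : Matrix m n ℂ → ℝ) (A L : Matrix m n ℂ) : Prop :=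
  L.rank ≤ r ∧ ∀ B : Matrix m n ℂ, B.rank ≤ r → nrm (A - L) ≤ nrm (A - B)

/-- Best rank-`r` approximation in Frobenius norm (truncated SVD, `D_r`). -/
def IsBestRankApprox {m n : Type*} [Fintype m] [Fintype n] (r : ℕ)
    (A L : Matrix m n ℂ) : Prop :=
  IsBestApproxWrt r frobNorm A L

/-- Horizontal concatenation of two matrices. -/
def hcat {m a b : Type*} (A : Matrix m a ℂ) (B : Matrix m b ℂ) :
    Matrix m (a ⊕ b) ℂ :=
  Matrix.of fun i => Sum.elim (A i) (B i)


section helpers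
set_option linter.all false
set_option linter.unusedSectionVars false
set_option linter.unusedSimpArgs false
set_option linter.deprecated false
open scoped Matrix.Norms.L2Operator ComplexOrder
variable {m n l : Type*} [Fintype m] [Fintype n] [Fintype l]
  [DecidableEq m] [DecidableEq n] [DecidableEq l]

/-- Euclidean norm of a plain vector. -/
def nv {m : Type*} [Fintype m] (v : m → ℂ) : ℝ := ‖WithLp.toLp 2 v‖

lemma nv_eq (v : m → ℂ) : nv v = Real.sqrt (∑ j, ‖v j‖ ^ 2) := by
  simp [nv, EuclideanSpace.norm_eq]

lemma nv_sq (v : m → ℂ) : nv v ^ 2 = ∑ j, ‖v j‖ ^ 2 := by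
  rw [nv_eq, Real.sq_sqrt (Finset.sum_nonneg fun _ _ => by positivity)]

lemma nv_nonneg (v : m → ℂ) : 0 ≤ nv v := norm_nonneg _

lemma nv_add (v w : m → ℂ) : nv (v + w) ≤ nv v + nv w := by
  simp only [nv, WithLp.toLp_add]; exact norm_add_le _ _

lemma nv_sub (v w : m → ℂ) : nv (v - w) ≤ nv v + nv w := by
  simp only [nv, WithLp.toLp_sub]; exact norm_sub_le _ _

lemma nv_smul (a : ℂ) (w : m → ℂ) : nv (a • w) = ‖a‖ * nv w := by
  simp only [nv, WithLp.toLp_smul]; exact norm_smul _ _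

lemma nv_star (v : m → ℂ) : nv (star v) = nv v := by
  simp [nv_eq]

lemma nv_sum {ι : Type*} (s : Finset ι) (f : ι → m → ℂ) :
    nv (∑ i ∈ s, f i) ≤ ∑ i ∈ s, nv (f i) := by
  simp only [nv, WithLp.toLp_sum]; exact norm_sum_le _ _

lemma nv_mulVec (A : Matrix m n ℂ) (v : n → ℂ) : nv (A *ᵥ v) ≤ ‖A‖ * nv v :=
  Matrix.l2_opNorm_mulVec A (WithLp.toLp 2 v)

lemma nv_row_mul (A : Matrix m n ℂ) (B : Matrix n l ℂ) (i : m) :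
    nv ((A * B) i) ≤ nv (A i) * ‖B‖ := by
  have h : (A * B) i = star (Bᴴ *ᵥ star (A i)) := by
    rw [Matrix.star_mulVec, star_star, Matrix.conjTranspose_conjTranspose]
    rfl
  rw [h, nv_star, mul_comm, ← Matrix.l2_opNorm_conjTranspose B, ← nv_star (A i)]
  exact nv_mulVec _ _

/-- a row of the product, bounded through the ℓ¹ norm of the row on the left -/
lemma nv_row_mul_l1 (A : Matrix m n ℂ) (B : Matrix n l ℂ) (i : m) (D R : ℝ)
    (hR : ∀ j, nv (B j) ≤ R) (hR0 : 0 ≤ R) (hD : ∑ j, ‖A i j‖ ≤ D) :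
    nv ((A * B) i) ≤ D * R := by
  have h : (A * B) i = ∑ j, A i j • B j := by
    ext k
    simp [Matrix.mul_apply, Finset.sum_apply]
  rw [h]
  refine (nv_sum _ _).trans ?_
  calc ∑ j, nv (A i j • B j) ≤ ∑ j, ‖A i j‖ * R := by
        refine Finset.sum_le_sum fun j _ => ?_
        rw [nv_smul]
        exact mul_le_mul_of_nonneg_left (hR j) (norm_nonneg _)
    _ = (∑ j, ‖A i j‖) * R := by rw [Finset.sum_mul]
    _ ≤ D * R := mul_le_mul_of_nonneg_right hD hR0

/-- Schur test -/
lemma schur_test (E : Matrix m n ℂ) (D : ℝ) (hD0 : 0 ≤ D)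
    (hr : ∀ i, ∑ j, ‖E i j‖ ≤ D) (hc : ∀ j, ∑ i, ‖E i j‖ ≤ D) : ‖E‖ ≤ D := by
  rw [Matrix.l2_opNorm_def]
  refine ContinuousLinearMap.opNorm_le_bound _ hD0 fun x => ?_
  change nv (E *ᵥ x.ofLp) ≤ D * nv x.ofLp
  refine (sq_le_sq₀ (nv_nonneg _) (mul_nonneg hD0 (nv_nonneg _))).mp ?_
  rw [mul_pow, nv_sq, nv_sq]
  set v := x.ofLp
  have h1 : ∀ i, ‖(E *ᵥ v) i‖ ^ 2 ≤ D * ∑ j, ‖E i j‖ * ‖v j‖ ^ 2 := by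
    intro i
    have a1 : ‖(E *ᵥ v) i‖ ≤ ∑ j, ‖E i j‖ * ‖v j‖ := by
      simp only [Matrix.mulVec, dotProduct]
      refine (norm_sum_le _ _).trans (le_of_eq ?_)
      simp
    have a2 : (∑ j, ‖E i j‖ * ‖v j‖) ^ 2 ≤ (∑ j, ‖E i j‖) * ∑ j, ‖E i j‖ * ‖v j‖ ^ 2 := by
      refine Finset.sum_sq_le_sum_mul_sum_of_sq_eq_mul _ ?_ ?_ ?_
      · intros; positivity
      · intros; positivity
      · intros; ring
    calc _ ≤ (∑ j, ‖E i j‖ * ‖v j‖) ^ 2 := by gcongr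
      _ ≤ _ := a2
      _ ≤ _ := by
        refine mul_le_mul_of_nonneg_right (hr i) (Finset.sum_nonneg fun _ _ => by positivity)
  calc _ ≤ ∑ i, D * ∑ j, ‖E i j‖ * ‖v j‖ ^ 2 := Finset.sum_le_sum fun i _ => h1 i
    _ = D * ∑ j, (∑ i, ‖E i j‖) * ‖v j‖ ^ 2 := by
        rw [← Finset.mul_sum, Finset.sum_comm]; simp_rw [Finset.sum_mul]
    _ ≤ D * ∑ j, D * ‖v j‖ ^ 2 := by
        refine mul_le_mul_of_nonneg_left (Finset.sum_le_sum fun j _ => ?_) hD0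
        exact mul_le_mul_of_nonneg_right (hc j) (by positivity)
    _ = _ := by rw [← Finset.mul_sum]; ring

lemma norm_le_one_of_idem {X : Matrix m m ℂ} (h : Xᴴ * X = X) : ‖X‖ ≤ 1 := by
  have := Matrix.l2_opNorm_conjTranspose_mul_self X
  rw [h] at this
  by_contra! hc
  nlinarith

lemma one_norm_le : ‖(1 : Matrix m m ℂ)‖ ≤ 1 := norm_le_one_of_idem (by simp)

lemma iso_norm_le {U : Matrix m n ℂ} (h : Uᴴ * U = 1) : ‖U‖ ≤ 1 := by
  have := Matrix.l2_opNorm_conjTranspose_mul_self U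
  rw [h] at this
  have h1 := one_norm_le (m := n)
  by_contra! hc
  nlinarith

lemma proj_idem {U : Matrix m n ℂ} (h : Uᴴ * U = 1) : (U * Uᴴ) * (U * Uᴴ) = U * Uᴴ := by
  rw [Matrix.mul_assoc, ← Matrix.mul_assoc Uᴴ, h, Matrix.one_mul]

lemma proj_norm_le {U : Matrix m n ℂ} (h : Uᴴ * U = 1) : ‖U * Uᴴ‖ ≤ 1 := by
  apply norm_le_one_of_idem
  simp [Matrix.conjTranspose_mul, proj_idem h]

lemma coproj_norm_le {U : Matrix m n ℂ} (h : Uᴴ * U = 1) : ‖1 - U * Uᴴ‖ ≤ 1 := by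
  apply norm_le_one_of_idem
  simp only [Matrix.conjTranspose_sub, Matrix.conjTranspose_one, Matrix.conjTranspose_mul,
    Matrix.conjTranspose_conjTranspose, Matrix.sub_mul, Matrix.mul_sub, Matrix.one_mul,
    Matrix.mul_one, proj_idem h, sub_self, sub_zero]

lemma mul_norm_le3 {m' : Type*} [Fintype m'] [DecidableEq m'] (A : Matrix m' m ℂ)
    (B : Matrix m n ℂ) (C : Matrix n l ℂ)
    (hA : ‖A‖ ≤ 1) (hC : ‖C‖ ≤ 1) : ‖A * B * C‖ ≤ ‖B‖ := by
  calc ‖A * B * C‖ ≤ ‖A * B‖ * ‖C‖ := Matrix.l2_opNorm_mul _ _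
    _ ≤ (‖A‖ * ‖B‖) * ‖C‖ := by gcongr; exact Matrix.l2_opNorm_mul _ _
    _ ≤ (1 * ‖B‖) * 1 := by gcongr
    _ = ‖B‖ := by ring

/-- squared Frobenius norm -/
def fs {m n : Type*} [Fintype m] [Fintype n] (M : Matrix m n ℂ) : ℝ := ∑ i, ∑ j, ‖M i j‖ ^ 2

lemma fs_nonneg (M : Matrix m n ℂ) : 0 ≤ fs M :=
  Finset.sum_nonneg fun _ _ => Finset.sum_nonneg fun _ _ => by positivity

lemma fs_trace (M : Matrix m n ℂ) : (fs M : ℂ) = (M * Mᴴ).trace := by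
  simp [fs, Matrix.trace, Matrix.mul_apply, Complex.mul_conj, Complex.normSq_eq_norm_sq]

lemma fs_conjTranspose (M : Matrix m n ℂ) : fs Mᴴ = fs M := by
  simp only [fs, Matrix.conjTranspose_apply, norm_star]
  exact Finset.sum_comm

lemma fs_add (X Y : Matrix m n ℂ) (h : X * Yᴴ = 0) : fs (X + Y) = fs X + fs Y := by
  have h2 : Y * Xᴴ = 0 := by
    have := congrArg Matrix.conjTranspose h
    simpa using this
  have : (fs (X + Y) : ℂ) = ((fs X + fs Y : ℝ) : ℂ) := by
    push_cast
    rw [fs_trace, fs_trace, fs_trace, Matrix.conjTranspose_add, Matrix.add_mul, Matrix.mul_add,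
      Matrix.mul_add, h, h2]
    simp
  exact_mod_cast this

lemma fs_eq_zero {M : Matrix m n ℂ} (h : fs M = 0) : M = 0 := by
  ext i j
  have h1 := (Finset.sum_eq_zero_iff_of_nonneg
    (fun i _ => Finset.sum_nonneg fun j _ => by positivity)).mp h i (Finset.mem_univ _)
  have h2 := (Finset.sum_eq_zero_iff_of_nonneg
    (fun j _ => by positivity)).mp h1 j (Finset.mem_univ _)
  simpa using h2

lemma best_fs {r : ℕ} {A B : Matrix m n ℂ} (h : IsBestRankApprox r A B)
    (C : Matrix m n ℂ) (hC : C.rank ≤ r) : fs (A - B) ≤ fs (A - C) := by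
  have := h.2 C hC
  exact (Real.sqrt_le_sqrt_iff (fs_nonneg _)).mp this

lemma best_conj {r : ℕ} {A B : Matrix m n ℂ} (h : IsBestRankApprox r A B) :
    IsBestRankApprox r Aᴴ Bᴴ := by
  refine ⟨by rw [Matrix.rank_conjTranspose]; exact h.1, fun C hC => ?_⟩
  have := best_fs h Cᴴ (by rw [Matrix.rank_conjTranspose]; exact hC)
  refine Real.sqrt_le_sqrt ?_
  change fs _ ≤ fs _
  rw [← fs_conjTranspose (A - B), ← fs_conjTranspose (A - Cᴴ)] at this
  simpa using this

lemma rank_mulproj {r : ℕ} (A : Matrix m n ℂ) (W : Matrix n (Fin r) ℂ) :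
    (A * (W * Wᴴ)).rank ≤ r := by
  rw [← Matrix.mul_assoc]
  refine (Matrix.rank_mul_le_left _ _).trans ((Matrix.rank_le_card_width _).trans ?_)
  simp

/-- optimality forces `B = A V Vᴴ` -/
lemma best_proj {r : ℕ} {A B : Matrix m n ℂ} (h : IsBestRankApprox r A B)
    {W : Matrix n (Fin r) ℂ} (hW : Wᴴ * W = 1) (hB : B * (W * Wᴴ) = B) :
    A * (W * Wᴴ) = B := by
  have h1 := best_fs h (A * (W * Wᴴ)) (rank_mulproj A W)
  have hi := proj_idem hW
  have h2 := fs_add (A - A * (W * Wᴴ)) (A * (W * Wᴴ) - B) (by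
    have e : (A * (W * Wᴴ) - B) = (A - B) * (W * Wᴴ) := by rw [Matrix.sub_mul, hB]
    rw [e, Matrix.conjTranspose_mul (A - B)]
    simp only [Matrix.conjTranspose_mul W, Matrix.conjTranspose_conjTranspose]
    rw [← Matrix.mul_assoc, Matrix.sub_mul, Matrix.mul_assoc A, hi, sub_self, Matrix.zero_mul])
  rw [sub_add_sub_cancel] at h2
  have h3 : fs (A * (W * Wᴴ) - B) = 0 := by
    have := fs_nonneg (A * (W * Wᴴ) - B); linarith
  exact sub_eq_zero.mp (fs_eq_zero h3)

lemma fs_mul_iso {r : ℕ} (A : Matrix m n ℂ) {W : Matrix n (Fin r) ℂ} (hW : Wᴴ * W = 1) :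
    fs (A - A * (W * Wᴴ)) = fs A - fs (A * W) := by
  have hi := proj_idem hW
  have h2 := fs_add (A - A * (W * Wᴴ)) (A * (W * Wᴴ)) (by
    rw [Matrix.conjTranspose_mul A]
    simp only [Matrix.conjTranspose_mul W, Matrix.conjTranspose_conjTranspose]
    rw [← Matrix.mul_assoc, Matrix.sub_mul, Matrix.mul_assoc A, hi, sub_self, Matrix.zero_mul])
  rw [sub_add_cancel] at h2
  have h3 : fs (A * (W * Wᴴ)) = fs (A * W) := by
    have : (fs (A * (W * Wᴴ)) : ℂ) = fs (A * W) := by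
      rw [fs_trace, fs_trace, ← Matrix.mul_assoc, Matrix.conjTranspose_mul (A * W),
        Matrix.conjTranspose_conjTranspose, Matrix.mul_assoc (A * W), ← Matrix.mul_assoc Wᴴ, hW,
        Matrix.one_mul]
    exact_mod_cast this
  linarith

lemma fs_cols (M : Matrix m n ℂ) : fs M = ∑ j, nv (M.col j) ^ 2 := by
  simp only [nv_sq, fs, Matrix.col_apply]
  exact Finset.sum_comm

lemma best_max {r : ℕ} {A B : Matrix m n ℂ} (h : IsBestRankApprox r A B)
    {V W : Matrix n (Fin r) ℂ} (hV : Vᴴ * V = 1) (hB : B * (V * Vᴴ) = B) (hW : Wᴴ * W = 1) :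
    fs (A * W) ≤ fs (A * V) := by
  have h1 := best_fs h (A * (W * Wᴴ)) (rank_mulproj A W)
  rw [← best_proj h hV hB, fs_mul_iso A hV, fs_mul_iso A hW] at h1
  linarith

/-- replacing one column of the optimal frame does not help -/
lemma best_col {r : ℕ} {A B : Matrix m n ℂ} (h : IsBestRankApprox r A B)
    {V : Matrix n (Fin r) ℂ} (hV : Vᴴ * V = 1) (hB : B * (V * Vᴴ) = B) (q : Fin r)
    (v : n → ℂ) (hv1 : star v ⬝ᵥ v = 1) (hv : ∀ i, i ≠ q → (Vᴴ *ᵥ v) i = 0) :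
    nv (A *ᵥ v) ≤ nv ((A * V).col q) := by
  have hv' : ∀ i, i ≠ q → star v ⬝ᵥ V.col i = 0 := by
    intro i hi
    have := congrArg star (hv i hi)
    simpa [Matrix.mulVec, dotProduct, mul_comm] using this
  have hW : (V.updateCol q v)ᴴ * (V.updateCol q v) = 1 := by
    ext i j
    have hij := congrFun (congrFun hV i) j
    simp only [Matrix.mul_apply, Matrix.conjTranspose_apply, Matrix.updateCol_apply] at hij ⊢
    by_cases hi : i = q <;> by_cases hj : j = q
    · subst hi; subst hj
      simpa [dotProduct] using hv1
    · subst hi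
      rw [Matrix.one_apply_ne (Ne.symm hj)]
      simpa [hj, dotProduct] using hv' j hj
    · subst hj
      rw [Matrix.one_apply_ne hi]
      simpa [hi, dotProduct, Matrix.mulVec] using hv i hi
    · simpa [hi, hj] using hij
  have h1 := best_max h hV hB hW
  rw [fs_cols, fs_cols, ← Finset.add_sum_erase _ _ (Finset.mem_univ q),
    ← Finset.add_sum_erase (a := q) _ (fun j => nv ((A * V).col j) ^ 2) (Finset.mem_univ q)] at h1
  have h2 : ∑ j ∈ Finset.univ.erase q, nv ((A * V.updateCol q v).col j) ^ 2
      = ∑ j ∈ Finset.univ.erase q, nv ((A * V).col j) ^ 2 := by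
    refine Finset.sum_congr rfl fun j hj => ?_
    have hj := Finset.ne_of_mem_erase hj
    congr 2
    ext i
    simp [Matrix.mul_apply, Matrix.updateCol_apply, hj]
  have h3 : (A * V.updateCol q v).col q = A *ᵥ v := by
    ext i
    simp [Matrix.mul_apply, Matrix.updateCol_apply, Matrix.mulVec, dotProduct]
  rw [h2, h3] at h1
  exact (sq_le_sq₀ (nv_nonneg _) (nv_nonneg _)).mp (by linarith)

lemma exists_sorted_eig {n : ℕ} (G : Matrix (Fin n) (Fin n) ℂ) (hG : G.IsHermitian) :
    ∃ (Z : Matrix (Fin n) (Fin n) ℂ) (lam : Fin n → ℝ), Zᴴ * Z = 1 ∧ Antitone lam ∧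
      Zᴴ * G * Z = Matrix.diagonal (fun i => (lam i : ℂ)) := by
  let ev := hG.eigenvalues
  let ρ := Tuple.sort (fun i => - ev i)
  have hmono := Tuple.monotone_sort (fun i => - ev i)
  let Y : Matrix (Fin n) (Fin n) ℂ := hG.eigenvectorUnitary
  have hY : Yᴴ * Y = 1 := Unitary.coe_star_mul_self hG.eigenvectorUnitary
  have hY2 : Yᴴ * G * Y = Matrix.diagonal (fun i => (ev i : ℂ)) := by
    have := hG.conjStarAlgAut_star_eigenvectorUnitary
    rw [Unitary.conjStarAlgAut_apply] at this
    simpa [Matrix.star_eq_conjTranspose, Y, ev, Function.comp_def] using this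
  refine ⟨Y.submatrix id ρ, fun i => ev (ρ i), ?_, ?_, ?_⟩
  · have : (Y.submatrix id ρ)ᴴ * Y.submatrix id ρ = (Yᴴ * Y).submatrix ρ ρ := by
      ext i j; simp [Matrix.mul_apply]
    rw [this, hY, Matrix.submatrix_one_equiv]
  · intro i j hij
    have := hmono hij
    simp only [Function.comp_apply, neg_le_neg_iff] at this
    exact this
  · have : (Y.submatrix id ρ)ᴴ * G * Y.submatrix id ρ = (Yᴴ * G * Y).submatrix ρ ρ := by
      ext i j; simp [Matrix.mul_apply]
    rw [this, hY2, Matrix.submatrix_diagonal_equiv]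
    rfl

lemma gram_diag (M : Matrix m n ℂ) (j : n) : (Mᴴ * M) j j = ((nv (M.col j) ^ 2 : ℝ) : ℂ) := by
  rw [nv_sq]
  simp [Matrix.mul_apply, mul_comm, Complex.mul_conj, Complex.normSq_eq_norm_sq]

lemma exists_trunc {n r : ℕ} (h : r ≤ n) (B : Matrix m (Fin n) ℂ) (hB : B.rank ≤ r) :
    ∃ (V : Matrix (Fin n) (Fin r) ℂ) (lam : Fin r → ℝ), Vᴴ * V = 1 ∧ Antitone lam ∧
      (B * V)ᴴ * (B * V) = Matrix.diagonal (fun i => (lam i : ℂ)) ∧ B * (V * Vᴴ) = B := by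
  obtain ⟨k, rfl⟩ := Nat.exists_eq_add_of_le h
  obtain ⟨Z, lam, hZ, hl, hd⟩ := exists_sorted_eig (Bᴴ * B) (Matrix.isHermitian_conjTranspose_mul_self B)
  have hZ' : Z * Zᴴ = 1 := mul_eq_one_comm.mp hZ
  have hd' : (B * Z)ᴴ * (B * Z) = Matrix.diagonal (fun i => (lam i : ℂ)) := by
    rw [← hd, Matrix.conjTranspose_mul]; simp only [Matrix.mul_assoc]
  have hlam : ∀ j, lam j = nv ((B * Z).col j) ^ 2 := by
    intro j
    have h1 := gram_diag (B * Z) j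
    rw [hd', Matrix.diagonal_apply_eq] at h1
    exact_mod_cast h1
  have hrank : (Finset.univ.filter fun j => lam j ≠ 0).card ≤ r := by
    have h1 : (Matrix.diagonal (fun i => (lam i : ℂ))).rank ≤ r := by
      rw [← hd']
      exact (Matrix.rank_mul_le_right _ _).trans ((Matrix.rank_mul_le_left _ _).trans hB)
    rw [Matrix.rank_diagonal, Fintype.card_subtype] at h1
    refine le_trans (le_of_eq ?_) h1
    congr 1
    ext j
    simp
  have hzero : ∀ j : Fin k, lam (Fin.natAdd r j) = 0 := by
    intro j
    by_contra hne
    have hpos : 0 < lam (Fin.natAdd r j) := lt_of_le_of_ne (by rw [hlam]; positivity) (Ne.symm hne)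
    have hsub : Finset.Iic (Fin.natAdd r j) ⊆ Finset.univ.filter fun j => lam j ≠ 0 := by
      intro i hi
      have := hl (Finset.mem_Iic.mp hi)
      simp only [Finset.mem_filter, Finset.mem_univ, true_and]
      exact (lt_of_lt_of_le hpos this).ne'
    have := Finset.card_le_card hsub
    rw [Fin.card_Iic] at this
    simp only [Fin.val_natAdd] at this
    omega
  have hcol : ∀ (j : Fin k) a, (B * Z) a (Fin.natAdd r j) = 0 := by
    intro j a
    have h1 := hzero j
    rw [hlam, nv_sq] at h1
    have := (Finset.sum_eq_zero_iff_of_nonneg (fun j _ => by positivity)).mp h1 a (Finset.mem_univ _)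
    simpa using this
  refine ⟨Z.submatrix id (Fin.castAdd k), fun i => lam (Fin.castAdd k i), ?_, ?_, ?_, ?_⟩
  · have : (Z.submatrix id (Fin.castAdd k))ᴴ * Z.submatrix id (Fin.castAdd k)
        = (Zᴴ * Z).submatrix (Fin.castAdd k) (Fin.castAdd k : Fin r → _) := by
      ext i j; simp [Matrix.mul_apply]
    rw [this, hZ]
    exact Matrix.submatrix_one _ (Fin.castAdd_injective r k)
  · intro i j hij
    exact hl (show Fin.castAdd k i ≤ Fin.castAdd k j from hij)
  · have : (B * Z.submatrix id (Fin.castAdd k))ᴴ * (B * Z.submatrix id (Fin.castAdd k))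
        = ((B * Z)ᴴ * (B * Z)).submatrix (Fin.castAdd k) (Fin.castAdd k : Fin r → _) := by
      ext i j; simp [Matrix.mul_apply]
    rw [this, hd', Matrix.submatrix_diagonal _ _ (Fin.castAdd_injective r k)]
    rfl
  · have h1 : B = (B * Z) * Zᴴ := by rw [Matrix.mul_assoc, hZ', Matrix.mul_one]
    conv_rhs => rw [h1]
    rw [← Matrix.mul_assoc]
    ext a b
    rw [Matrix.mul_apply, Matrix.mul_apply, Fin.sum_univ_add]
    simp only [hcol, zero_mul, Finset.sum_const_zero, add_zero]
    refine Finset.sum_congr rfl fun j _ => ?_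
    simp [Matrix.mul_apply]

lemma nv_sq_dot (v : m → ℂ) : ((nv v ^ 2 : ℝ) : ℂ) = star v ⬝ᵥ v := by
  rw [nv_sq]
  simp [dotProduct, mul_comm, Complex.mul_conj, Complex.normSq_eq_norm_sq]

lemma nv_iso {U : Matrix m n ℂ} (h : Uᴴ * U = 1) (v : n → ℂ) : nv (U *ᵥ v) = nv v := by
  have : ((nv (U *ᵥ v) ^ 2 : ℝ) : ℂ) = ((nv v ^ 2 : ℝ) : ℂ) := by
    rw [nv_sq_dot, nv_sq_dot, Matrix.star_mulVec, ← Matrix.dotProduct_mulVec, Matrix.mulVec_mulVec,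
      h, Matrix.one_mulVec]
  have h2 : nv (U *ᵥ v) ^ 2 = nv v ^ 2 := by exact_mod_cast this
  exact (sq_eq_sq₀ (nv_nonneg _) (nv_nonneg _)).mp h2

lemma nv_pos {v : m → ℂ} (h : v ≠ 0) : 0 < nv v := by
  refine norm_pos_iff.mpr ?_
  simpa using h

lemma exists_test {r : ℕ} (V V1 : Matrix n (Fin r) ℂ) (hV : Vᴴ * V = 1) (q : Fin r) :
    ∃ a : Fin r → ℂ, nv a = 1 ∧ ∀ i, i ≠ q → (V1ᴴ *ᵥ (V *ᵥ a)) i = 0 := by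
  have hdet : ((V1ᴴ * V).updateRow q 0).det = 0 :=
    Matrix.det_eq_zero_of_row_eq_zero q (by simp)
  obtain ⟨a, ha, h0⟩ := Matrix.exists_mulVec_eq_zero_iff.mpr hdet
  have hp := nv_pos ha
  refine ⟨((nv a)⁻¹ : ℂ) • a, ?_, ?_⟩
  · rw [nv_smul]
    simp only [norm_inv, Complex.norm_real, Real.norm_eq_abs, abs_of_pos hp]
    field_simp
  · intro i hi
    have := congrFun h0 i
    rw [Matrix.mulVec_smul, Matrix.mulVec_smul, Matrix.mulVec_mulVec, Pi.smul_apply]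
    have e : ((V1ᴴ * V) *ᵥ a) i = 0 := by
      have h9 : ((V1ᴴ * V) *ᵥ a) i = ((V1ᴴ * V).updateRow q 0 *ᵥ a) i := by
        simp only [Matrix.mulVec, Matrix.updateRow_ne hi]
      rw [h9, this]; rfl
    rw [e, smul_zero]

lemma norm_diag_le {r : ℕ} (d : Fin r → ℂ) (b : ℝ) (hb : 0 ≤ b) (h : ∀ i, ‖d i‖ ≤ b) :
    ‖Matrix.diagonal d‖ ≤ b := by
  rw [Matrix.l2_opNorm_diagonal]
  exact (pi_norm_le_iff_of_nonneg hb).mpr h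

lemma svd_of_best {N r : ℕ} (A B L : Matrix m (Fin N) ℂ)
    (hbest : IsBestRankApprox r A B) (U : Matrix m (Fin r) ℂ) (σ : Fin r → ℝ)
    (V : Matrix (Fin N) (Fin r) ℂ) (hL : IsSVD L U σ V) (s ε ra : ℝ) (q : Fin r)
    (hq : ∀ i : Fin r, i ≤ q)
    (hs : ∀ i, s ≤ σ i) (hs0 : 0 ≤ s) (hε : ‖A - L‖ ≤ ε) (hpos : 0 < s - ε)
    (hra : ∀ i, nv (A i) ≤ ra) (hca : ∀ i, nv (Aᴴ i) ≤ ra) :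
    ∃ (U1 : Matrix m (Fin r) ℂ) (σ1 : Fin r → ℝ) (V1 : Matrix (Fin N) (Fin r) ℂ),
      IsSVD B U1 σ1 V1 ∧ (∀ i, nv (U1 i) ≤ ra * (s - ε)⁻¹) ∧
        (∀ i, nv (V1 i) ≤ ra * (s - ε)⁻¹) := by
  obtain ⟨hU, hV, hσ, hmono, hLeq⟩ := hL
  have hrN : r ≤ N := by
    have h1 : (Vᴴ * V).rank ≤ N :=
      (Matrix.rank_mul_le_right _ _).trans (by simpa using Matrix.rank_le_card_height V)
    rw [hV, Matrix.rank_one] at h1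
    simpa using h1
  obtain ⟨V1, lam, hV1, hlam, hgram, hBV⟩ := exists_trunc hrN B hbest.1
  have hAB := best_proj hbest hV1 hBV
  have hAV : B * V1 = A * V1 := by
    rw [← hAB, Matrix.mul_assoc, Matrix.mul_assoc, hV1, Matrix.mul_one]
  obtain ⟨a, ha1, ha⟩ := exists_test V V1 hV q
  have hcol := best_col hbest hV1 hBV q (V *ᵥ a) (by
    rw [← nv_sq_dot, nv_iso hV, ha1]; simp) ha
  have hlamq : ∀ j, lam j = nv ((B * V1).col j) ^ 2 := by
    intro j
    have h1 := gram_diag (B * V1) j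
    rw [hgram, Matrix.diagonal_apply_eq] at h1
    exact_mod_cast h1
  have hlow : s - ε ≤ nv (A *ᵥ (V *ᵥ a)) := by
    have e : L *ᵥ (V *ᵥ a) = A *ᵥ (V *ᵥ a) - (A - L) *ᵥ (V *ᵥ a) := by
      rw [Matrix.sub_mulVec]; abel
    have h1 : s ≤ nv (L *ᵥ (V *ᵥ a)) := by
      have e2 : L *ᵥ (V *ᵥ a) = U *ᵥ (Matrix.diagonal (fun i => (σ i : ℂ)) *ᵥ a) := by
        rw [hLeq, Matrix.mulVec_mulVec, Matrix.mul_assoc, hV, Matrix.mul_one, Matrix.mulVec_mulVec]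
      rw [e2, nv_iso hU]
      refine (sq_le_sq₀ hs0 (nv_nonneg _)).mp ?_
      have h2 : s ^ 2 * nv a ^ 2 ≤ nv (Matrix.diagonal (fun i => (σ i : ℂ)) *ᵥ a) ^ 2 := by
        rw [nv_sq, nv_sq, Finset.mul_sum]
        refine Finset.sum_le_sum fun i _ => ?_
        rw [Matrix.mulVec_diagonal, norm_mul, mul_pow, Complex.norm_real, Real.norm_eq_abs, sq_abs]
        have := hs i
        gcongr
      simpa [ha1] using h2
    have h3 := nv_sub (A *ᵥ (V *ᵥ a)) ((A - L) *ᵥ (V *ᵥ a))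
    rw [← e] at h3
    have h4 := nv_mulVec (A - L) (V *ᵥ a)
    rw [nv_iso hV, ha1, mul_one] at h4
    linarith
  rw [← hAV] at hcol
  have hsq : ∀ j, s - ε ≤ Real.sqrt (lam j) := by
    intro j
    refine Real.le_sqrt_of_sq_le ?_
    refine le_trans ?_ (hlam (hq j))
    rw [hlamq]
    have := hlow.trans hcol
    gcongr
  let σ1 : Fin r → ℝ := fun j => Real.sqrt (lam j)
  have hσ1 : ∀ j, 0 < σ1 j := fun j => hpos.trans_le (hsq j)
  have hσ1c : ∀ j, (σ1 j : ℂ) ≠ 0 := fun j => by exact_mod_cast (hσ1 j).ne'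
  let Di : Matrix (Fin r) (Fin r) ℂ := Matrix.diagonal (fun j => ((σ1 j : ℂ))⁻¹)
  let Ds : Matrix (Fin r) (Fin r) ℂ := Matrix.diagonal (fun j => (σ1 j : ℂ))
  have hDiH : Diᴴ = Di := by
    simp only [Di, Matrix.diagonal_conjTranspose]
    congr 1; ext j; simp
  have hDsH : Dsᴴ = Ds := by
    simp only [Ds, Matrix.diagonal_conjTranspose]
    congr 1; ext j; simp
  have hDD : Di * Ds = 1 := by
    simp only [Di, Ds, Matrix.diagonal_mul_diagonal]
    rw [← Matrix.diagonal_one]; congr 1; ext j; exact inv_mul_cancel₀ (hσ1c j)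
  have hDD2 : Ds * Di = 1 := mul_eq_one_comm.mp hDD
  have hgram' : (B * V1)ᴴ * (B * V1) = Ds * Ds := by
    rw [hgram]
    simp only [Ds, Matrix.diagonal_mul_diagonal]
    congr 1; ext j
    rw [← Complex.ofReal_mul]
    congr 1
    exact (Real.mul_self_sqrt (by rw [hlamq]; positivity)).symm
  have hDin : ‖Di‖ ≤ (s - ε)⁻¹ := by
    refine norm_diag_le _ _ (by positivity) fun j => ?_
    rw [norm_inv, Complex.norm_real, Real.norm_eq_abs, abs_of_pos (hσ1 j)]
    exact inv_anti₀ hpos (hsq j)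
  have mulDV : ‖V1 * Di‖ ≤ (s - ε)⁻¹ := by
    refine (Matrix.l2_opNorm_mul _ _).trans ?_
    calc ‖V1‖ * ‖Di‖ ≤ 1 * (s - ε)⁻¹ :=
          mul_le_mul (iso_norm_le hV1) hDin (norm_nonneg _) zero_le_one
      _ = _ := one_mul _
  let U1 : Matrix m (Fin r) ℂ := B * V1 * Di
  have hU1 : U1ᴴ * U1 = 1 := by
    simp only [U1]
    rw [Matrix.conjTranspose_mul, hDiH, Matrix.mul_assoc, ← Matrix.mul_assoc (B * V1)ᴴ, hgram',
      Matrix.mul_assoc Ds, hDD2, Matrix.mul_one, hDD]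
  have mulDU : ‖U1 * Di‖ ≤ (s - ε)⁻¹ := by
    refine (Matrix.l2_opNorm_mul _ _).trans ?_
    calc ‖U1‖ * ‖Di‖ ≤ 1 * (s - ε)⁻¹ :=
          mul_le_mul (iso_norm_le hU1) hDin (norm_nonneg _) zero_le_one
      _ = _ := one_mul _
  have hBeq : B = U1 * Ds * V1ᴴ := by
    simp only [U1]
    rw [Matrix.mul_assoc (B * V1), hDD, Matrix.mul_one, Matrix.mul_assoc, hBV]
  have hBH : Bᴴ = V1 * Ds * U1ᴴ := by
    conv_lhs => rw [hBeq]
    rw [Matrix.conjTranspose_mul, Matrix.conjTranspose_mul, hDsH, Matrix.conjTranspose_conjTranspose,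
      Matrix.mul_assoc]
  have hBHU : Bᴴ * (U1 * U1ᴴ) = Bᴴ := by
    rw [hBH, Matrix.mul_assoc, ← Matrix.mul_assoc U1ᴴ, hU1, Matrix.one_mul]
  have hAH := best_proj (best_conj hbest) hU1 hBHU
  have hV1eq : V1 = Aᴴ * (U1 * Di) := by
    have h1 : Bᴴ * (U1 * Di) = V1 := by
      rw [hBH, Matrix.mul_assoc, ← Matrix.mul_assoc U1ᴴ, hU1, Matrix.one_mul, Matrix.mul_assoc,
        hDD2, Matrix.mul_one]
    rw [← hAH, Matrix.mul_assoc, Matrix.mul_assoc U1, ← Matrix.mul_assoc U1ᴴ, hU1,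
      Matrix.one_mul] at h1
    exact h1.symm
  have hU1eq : U1 = A * (V1 * Di) := by
    simp only [U1]; rw [hAV, Matrix.mul_assoc]
  refine ⟨U1, σ1, V1, ⟨hU1, hV1, hσ1, fun i j hij => Real.sqrt_le_sqrt (hlam hij), hBeq⟩, ?_, ?_⟩
  · intro i
    have h0 : 0 ≤ ra := (nv_nonneg _).trans (hra i)
    rw [hU1eq]
    refine (nv_row_mul _ _ i).trans ?_
    exact mul_le_mul (hra i) mulDV (norm_nonneg _) h0
  · intro i
    have h0 : 0 ≤ ra := (nv_nonneg _).trans (hca i)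
    rw [hV1eq]
    refine (nv_row_mul _ _ i).trans ?_
    exact mul_le_mul (hca i) mulDU (norm_nonneg _) h0

lemma tangent_decomp {r : ℕ} (Uk : Matrix m (Fin r) ℂ) (Vk : Matrix n (Fin r) ℂ)
    (L E : Matrix m n ℂ) :
    tangentProj Uk Vk (L + E) - L = - ((1 - Uk * Ukᴴ) * L * (1 - Vk * Vkᴴ))
      + (Uk * Ukᴴ * E * (1 - Vk * Vkᴴ) + E * (Vk * Vkᴴ)) := by
  simp only [tangentProj, Matrix.mul_add, Matrix.add_mul, Matrix.mul_sub, Matrix.sub_mul,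
    Matrix.mul_one, Matrix.one_mul]
  abel

lemma tangent_conj {r : ℕ} (Uk : Matrix m (Fin r) ℂ) (Vk : Matrix n (Fin r) ℂ)
    (M : Matrix m n ℂ) : (tangentProj Uk Vk M)ᴴ = tangentProj Vk Uk Mᴴ := by
  simp only [tangentProj, Matrix.conjTranspose_add, Matrix.conjTranspose_sub,
    Matrix.conjTranspose_mul, Matrix.conjTranspose_conjTranspose, Matrix.mul_assoc]
  abel

lemma resid {r : ℕ} {L Lk : Matrix m n ℂ} {Uk : Matrix m (Fin r) ℂ} {σk : Fin r → ℝ}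
    {Vk : Matrix n (Fin r) ℂ} (hLk : IsSVD Lk Uk σk Vk) :
    L * (1 - Vk * Vkᴴ) = (L - Lk) * (1 - Vk * Vkᴴ) := by
  obtain ⟨hU, hV, _, _, rfl⟩ := hLk
  have : Uk * Matrix.diagonal (fun i => (σk i : ℂ)) * Vkᴴ * (1 - Vk * Vkᴴ) = 0 := by
    rw [Matrix.mul_sub, Matrix.mul_one, Matrix.mul_assoc _ Vkᴴ, ← Matrix.mul_assoc Vkᴴ, hV,
      Matrix.one_mul, sub_self]
  rw [Matrix.sub_mul, this, sub_zero]

lemma tangent_op {r : ℕ} {L Lk E : Matrix m n ℂ} {Uk : Matrix m (Fin r) ℂ} {σk : Fin r → ℝ}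
    {Vk : Matrix n (Fin r) ℂ} (hLk : IsSVD Lk Uk σk Vk) (t D : ℝ)
    (ht : ‖L - Lk‖ ≤ t) (hE : ‖E‖ ≤ D) :
    ‖tangentProj Uk Vk (L + E) - L‖ ≤ t + 2 * D := by
  rw [tangent_decomp]
  have h1 : ‖(1 - Uk * Ukᴴ) * L * (1 - Vk * Vkᴴ)‖ ≤ t := by
    rw [Matrix.mul_assoc, resid hLk, ← Matrix.mul_assoc]
    exact (mul_norm_le3 _ _ _ (coproj_norm_le hLk.1) (coproj_norm_le hLk.2.1)).trans ht
  have h2 : ‖Uk * Ukᴴ * E * (1 - Vk * Vkᴴ)‖ ≤ D :=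
    (mul_norm_le3 _ _ _ (proj_norm_le hLk.1) (coproj_norm_le hLk.2.1)).trans hE
  have h3 : ‖E * (Vk * Vkᴴ)‖ ≤ D := by
    have := mul_norm_le3 (1 : Matrix m m ℂ) E _ one_norm_le (proj_norm_le hLk.2.1)
    rw [Matrix.one_mul] at this
    exact this.trans hE
  refine (norm_add_le _ _).trans ?_
  rw [norm_neg]
  have := norm_add_le (Uk * Ukᴴ * E * (1 - Vk * Vkᴴ)) (E * (Vk * Vkᴴ))
  linarith

lemma tangent_row {r : ℕ} {L Lk E : Matrix m n ℂ} {U : Matrix m (Fin r) ℂ} {σ : Fin r → ℝ}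
    {V : Matrix n (Fin r) ℂ} (hL : IsSVD L U σ V)
    {Uk : Matrix m (Fin r) ℂ} {σk : Fin r → ℝ}
    {Vk : Matrix n (Fin r) ℂ} (hLk : IsSVD Lk Uk σk Vk) (t D R Rk S : ℝ)
    (hR0 : 0 ≤ R) (hRk0 : 0 ≤ Rk)
    (ht : ‖L - Lk‖ ≤ t) (hE : ‖E‖ ≤ D) (hS : ‖L‖ ≤ S) (hU : ∀ i, nv (U i) ≤ R)
    (hUk : ∀ i, nv (Uk i) ≤ Rk) (hVk : ∀ i, nv (Vk i) ≤ Rk)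
    (hrow : ∀ i, ∑ j, ‖E i j‖ ≤ D) (i : m) :
    nv (tangentProj Uk Vk (L + E) i) ≤ R * S + (R + Rk) * t + 2 * (Rk * D) := by
  have hUL : U * (Uᴴ * L) = L := by
    obtain ⟨hU, hV, _, _, hh⟩ := hL
    rw [hh, Matrix.mul_assoc U, ← Matrix.mul_assoc Uᴴ, hU, Matrix.one_mul]
  have isoH : ∀ {X : Matrix m (Fin r) ℂ}, Xᴴ * X = 1 → ‖Xᴴ‖ ≤ 1 := fun h => by
    rw [Matrix.l2_opNorm_conjTranspose]; exact iso_norm_le h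
  have b0 : nv (L i) ≤ R * S := by
    conv_lhs => rw [← hUL]
    refine (nv_row_mul _ _ i).trans (mul_le_mul (hU i) ?_ (norm_nonneg _) hR0)
    have := mul_norm_le3 Uᴴ L (1 : Matrix n n ℂ) (isoH hL.1) one_norm_le
    rw [Matrix.mul_one] at this
    exact this.trans hS
  have b1 : nv (((1 - Uk * Ukᴴ) * L * (1 - Vk * Vkᴴ) : Matrix m n ℂ) i) ≤ (R + Rk) * t := by
    have e1 : (1 - Uk * Ukᴴ) * L * (1 - Vk * Vkᴴ)
        = ((1 - Uk * Ukᴴ) * U) * (Uᴴ * (L - Lk) * (1 - Vk * Vkᴴ)) := by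
      rw [Matrix.mul_assoc Uᴴ, ← resid hLk, ← Matrix.mul_assoc Uᴴ]
      conv_lhs => rw [← hUL]
      simp only [Matrix.mul_assoc]
    rw [e1]
    refine (nv_row_mul _ _ i).trans (mul_le_mul ?_ ?_ (norm_nonneg _) (by positivity))
    · have e2 : ((1 - Uk * Ukᴴ) * U : Matrix m (Fin r) ℂ) i = U i - (Uk * (Ukᴴ * U)) i := by
        rw [Matrix.sub_mul, Matrix.one_mul, Matrix.mul_assoc]; rfl
      rw [e2]
      refine (nv_sub _ _).trans (add_le_add (hU i) ?_)
      refine (nv_row_mul _ _ i).trans ?_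
      have h5 : ‖Ukᴴ * U‖ ≤ 1 := by
        refine (Matrix.l2_opNorm_mul _ _).trans ?_
        exact mul_le_one₀ (isoH hLk.1) (norm_nonneg _) (iso_norm_le hL.1)
      calc _ ≤ Rk * 1 := mul_le_mul (hUk i) h5 (norm_nonneg _) hRk0
        _ = Rk := mul_one _
    · exact (mul_norm_le3 _ _ _ (isoH hL.1) (coproj_norm_le hLk.2.1)).trans ht
  have b2 : nv ((Uk * Ukᴴ * E * (1 - Vk * Vkᴴ) : Matrix m n ℂ) i) ≤ Rk * D := by
    have e1 : Uk * Ukᴴ * E * (1 - Vk * Vkᴴ) = Uk * (Ukᴴ * E * (1 - Vk * Vkᴴ)) := by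
      simp only [Matrix.mul_assoc]
    rw [e1]
    refine (nv_row_mul _ _ i).trans (mul_le_mul (hUk i) ?_ (norm_nonneg _) hRk0)
    exact (mul_norm_le3 _ _ _ (isoH hLk.1) (coproj_norm_le hLk.2.1)).trans hE
  have b3 : nv ((E * (Vk * Vkᴴ)) i) ≤ Rk * D := by
    rw [← Matrix.mul_assoc]
    refine (nv_row_mul _ _ i).trans ?_
    have h5 : ‖Vkᴴ‖ ≤ 1 := by
      rw [Matrix.l2_opNorm_conjTranspose]; exact iso_norm_le hLk.2.1
    have h6 := nv_row_mul_l1 E Vk i D Rk hVk hRk0 (hrow i)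
    calc _ ≤ (D * Rk) * 1 := mul_le_mul h6 h5 (norm_nonneg _) ((nv_nonneg _).trans h6)
      _ = Rk * D := by ring
  have e3 : tangentProj Uk Vk (L + E) i = L i - ((1 - Uk * Ukᴴ) * L * (1 - Vk * Vkᴴ) : Matrix m n ℂ) i
      + ((Uk * Ukᴴ * E * (1 - Vk * Vkᴴ) : Matrix m n ℂ) i + (E * (Vk * Vkᴴ)) i) := by
    have h7 := congrFun (tangent_decomp Uk Vk L E) i
    have h8 : tangentProj Uk Vk (L + E) i = L i + (tangentProj Uk Vk (L + E) - L) i := by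
      change _ = L i + (tangentProj Uk Vk (L + E) i - L i)
      abel
    rw [h8, h7]
    change L i + (-(((1 - Uk * Ukᴴ) * L * (1 - Vk * Vkᴴ) : Matrix m n ℂ) i)
      + ((Uk * Ukᴴ * E * (1 - Vk * Vkᴴ) : Matrix m n ℂ) i + (E * (Vk * Vkᴴ)) i)) = _
    abel
  rw [e3]
  have c1 := nv_add (L i - ((1 - Uk * Ukᴴ) * L * (1 - Vk * Vkᴴ) : Matrix m n ℂ) i)
      ((Uk * Ukᴴ * E * (1 - Vk * Vkᴴ) : Matrix m n ℂ) i + (E * (Vk * Vkᴴ)) i)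
  have c2 := nv_add ((Uk * Ukᴴ * E * (1 - Vk * Vkᴴ) : Matrix m n ℂ) i) ((E * (Vk * Vkᴴ)) i)
  have c3 := nv_sub (L i) (((1 - Uk * Ukᴴ) * L * (1 - Vk * Vkᴴ) : Matrix m n ℂ) i)
  linarith

lemma svd_norm {r : ℕ} {L : Matrix m n ℂ} {U : Matrix m (Fin r) ℂ} {σ : Fin r → ℝ}
    {V : Matrix n (Fin r) ℂ} (hL : IsSVD L U σ V) (q : Fin r) (hq : ∀ i : Fin r, q ≤ i) :
    ‖L‖ = σ q := by
  obtain ⟨hU, hV, hpos, hmono, hh⟩ := hL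
  have isoH : ‖Uᴴ‖ ≤ 1 := by
    rw [Matrix.l2_opNorm_conjTranspose]; exact iso_norm_le hU
  have isoHV : ‖Vᴴ‖ ≤ 1 := by
    rw [Matrix.l2_opNorm_conjTranspose]; exact iso_norm_le hV
  have hd : ‖Matrix.diagonal (fun i => (σ i : ℂ))‖ = σ q := by
    apply le_antisymm
    · refine norm_diag_le _ _ (hpos q).le fun i => ?_
      rw [Complex.norm_real, Real.norm_eq_abs, abs_of_pos (hpos i)]
      exact hmono _ _ (hq i)
    · rw [Matrix.l2_opNorm_diagonal]
      have := norm_le_pi_norm (fun i => (σ i : ℂ)) q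
      rwa [Complex.norm_real, Real.norm_eq_abs, abs_of_pos (hpos q)] at this
  apply le_antisymm
  · rw [hh, ← hd]
    exact mul_norm_le3 _ _ _ (iso_norm_le hU) isoHV
  · have e : Uᴴ * L * V = Matrix.diagonal (fun i => (σ i : ℂ)) := by
      rw [hh, Matrix.mul_assoc U, ← Matrix.mul_assoc Uᴴ, hU, Matrix.one_mul, Matrix.mul_assoc, hV,
        Matrix.mul_one]
    rw [← hd, ← e]
    exact mul_norm_le3 _ _ _ isoH (iso_norm_le hV)

lemma svd_conj {r : ℕ} {L : Matrix m n ℂ} {U : Matrix m (Fin r) ℂ} {σ : Fin r → ℝ}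
    {V : Matrix n (Fin r) ℂ} (hL : IsSVD L U σ V) : IsSVD Lᴴ V σ U := by
  obtain ⟨hU, hV, hpos, hmono, hh⟩ := hL
  refine ⟨hV, hU, hpos, hmono, ?_⟩
  have hDsH : (Matrix.diagonal (fun i => (σ i : ℂ)))ᴴ = Matrix.diagonal (fun i => (σ i : ℂ)) := by
    simp only [Matrix.diagonal_conjTranspose]
    congr 1; ext j; simp
  rw [hh, Matrix.conjTranspose_mul, Matrix.conjTranspose_mul, hDsH,
    Matrix.conjTranspose_conjTranspose, Matrix.mul_assoc]

lemma rowNorm_le {M : Matrix m n ℂ} {b : ℝ} (h : rowNorm M ≤ b) (i : m) : nv (M i) ≤ b := by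
  rw [nv_eq]
  exact (le_ciSup (f := fun i => Real.sqrt (∑ j, ‖M i j‖ ^ 2)) (Set.finite_range _).bddAbove i).trans h

lemma le_rowNorm {M : Matrix m n ℂ} {b : ℝ} [Nonempty m] (h : ∀ i, nv (M i) ≤ b) :
    rowNorm M ≤ b := by
  refine ciSup_le fun i => ?_
  rw [← nv_eq]; exact h i

/-- the sparse error after thresholding -/
lemma thr_sum {N : ℕ} (x s xk : Fin N → ℂ) (ζ b D : ℝ) (h1 : ∀ t, ‖x t - xk t‖ ≤ ζ)
    (h2 : ∀ t, ‖x t - xk t‖ + ζ ≤ b) (hD : ((supp s).card : ℝ) * b ≤ D) :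
    ∑ t, ‖s t - hardThreshold ζ (x + s - xk) t‖ ≤ D := by
  have h0 : ∀ t, t ∉ supp s → ‖s t - hardThreshold ζ (x + s - xk) t‖ = 0 := by
    intro t ht
    have hs : s t = 0 := by simpa [supp] using ht
    have : ¬ ζ < ‖(x + s - xk) t‖ := by
      simpa [hs] using h1 t
    simp only [hardThreshold, this, if_false, hs, sub_zero, norm_zero]
  rw [← Finset.sum_subset (Finset.subset_univ (supp s)) (fun t _ ht => h0 t ht)]
  refine le_trans ?_ hD
  rw [← nsmul_eq_mul]
  refine Finset.sum_le_card_nsmul _ _ _ fun t _ => le_trans ?_ (h2 t)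
  have hz : 0 ≤ ζ := (norm_nonneg _).trans (h1 t)
  by_cases hh : ζ < ‖(x + s - xk) t‖
  · have e : s t - hardThreshold ζ (x + s - xk) t = -(x t - xk t) := by
      simp only [hardThreshold, hh, if_true]
      simp only [Pi.sub_apply, Pi.add_apply]; ring
    rw [e, norm_neg]; linarith
  · have e : s t - hardThreshold ζ (x + s - xk) t = (x + s - xk) t - (x t - xk t) := by
      simp only [hardThreshold, hh, if_false]
      simp only [Pi.sub_apply, Pi.add_apply]; ring
    rw [e]
    refine (norm_sub_le _ _).trans ?_
    push Not at hh
    linarith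

lemma hankel_row {n₁ n₂ N : ℕ} (hn : N + 1 = n₁ + n₂) (d : Fin N → ℂ) (i : Fin n₁) :
    ∑ j, ‖hankel hn d i j‖ ≤ ∑ t, ‖d t‖ := by
  let f : Fin n₂ → Fin N := fun j => ⟨i.1 + j.1, by have hi := i.2; have hj := j.2; omega⟩
  have hf : Function.Injective f := by
    intro a b hab
    simp only [f, Fin.mk.injEq] at hab
    exact Fin.ext (by omega)
  have : ∑ j, ‖hankel hn d i j‖ = ∑ t ∈ Finset.univ.image f, ‖d t‖ := by
    rw [Finset.sum_image hf.injOn]; rfl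
  rw [this]
  exact Finset.sum_le_sum_of_subset_of_nonneg (Finset.subset_univ _) fun _ _ _ => norm_nonneg _

lemma hankel_col {n₁ n₂ N : ℕ} (hn : N + 1 = n₁ + n₂) (d : Fin N → ℂ) (j : Fin n₂) :
    ∑ i, ‖hankel hn d i j‖ ≤ ∑ t, ‖d t‖ := by
  let f : Fin n₁ → Fin N := fun i => ⟨i.1 + j.1, by have hi := i.2; have hj := j.2; omega⟩
  have hf : Function.Injective f := by
    intro a b hab
    simp only [f, Fin.mk.injEq] at hab
    exact Fin.ext (by omega)
  have : ∑ i, ‖hankel hn d i j‖ = ∑ t ∈ Finset.univ.image f, ‖d t‖ := by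
    rw [Finset.sum_image hf.injOn]; rfl
  rw [this]
  exact Finset.sum_le_sum_of_subset_of_nonneg (Finset.subset_univ _) fun _ _ _ => norm_nonneg _

set_option maxHeartbeats 2000000 in
lemma core {n₁ n₂ N r : ℕ} (hn : N + 1 = n₁ + n₂) (h1 : 0 < n₁) (h2 : 0 < n₂) (p q : Fin r)
    (hp : ∀ i : Fin r, p ≤ i) (hq : ∀ i : Fin r, i ≤ q)
    (μ α κ cs τ β : ℝ) (hμ : 0 < μ) (hα : 0 < α) (x s : Fin N → ℂ)
    (U : Matrix (Fin n₁) (Fin r) ℂ) (σ : Fin r → ℝ) (V : Matrix (Fin n₂) (Fin r) ℂ)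
    (hL : IsSVD (hankel hn x) U σ V) (hcs : cs = csConst n₁ n₂ N)
    (hU : rowNorm U ≤ Real.sqrt (μ * cs * r / N)) (hV : rowNorm V ≤ Real.sqrt (μ * cs * r / N))
    (hκ : κ = σ p / σ q) (hs : IsSparse α s)
    (hτ : τ = 4 * α * μ * cs * r * κ) (hβ : β = μ * cs * r / (2 * κ * N)) (hτ1 : τ < 1 / 12)
    (γ : ℝ) (hγ : 0 < γ) (hγ1 : γ < 1) (k : ℕ) (Lk : Matrix (Fin n₁) (Fin n₂) ℂ) (xk : Fin N → ℂ)
    (Uk : Matrix (Fin n₁) (Fin r) ℂ) (σk : Fin r → ℝ) (Vk : Matrix (Fin n₂) (Fin r) ℂ)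
    (hLk : IsSVD Lk Uk σk Vk)
    (hUk : rowNorm Uk ≤ Real.sqrt (4 * μ * κ ^ 2 * cs * r / N))
    (hVk : rowNorm Vk ≤ Real.sqrt (4 * μ * κ ^ 2 * cs * r / N))
    (hLL : specNorm (hankel hn x - Lk) ≤ 2 * τ * γ ^ k * σ q)
    (hxx : vecMaxNorm (x - xk) ≤ (τ - 2 * τ ^ 2) / (8 * α * κ * N) * γ ^ k * σ q)
    (Lk1 : Matrix (Fin n₁) (Fin n₂) ℂ)
    (hbest : IsBestRankApprox r
        (tangentProj Uk Vk (hankel hn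
          (x + s - hardThreshold (β * γ ^ k * specNorm Lk) (x + s - xk)))) Lk1) :
    Real.sqrt (4 * μ * κ ^ 2 * cs * r / N) = 2 * κ * Real.sqrt (μ * cs * r / N) ∧
      ∃ (Uk1 : Matrix (Fin n₁) (Fin r) ℂ) (σk1 : Fin r → ℝ)
        (Vk1 : Matrix (Fin n₂) (Fin r) ℂ),
        IsSVD Lk1 Uk1 σk1 Vk1 ∧
        rowNorm Uk1 ≤ 2 * κ * Real.sqrt (μ * cs * r / N) ∧
        rowNorm Vk1 ≤ 2 * κ * Real.sqrt (μ * cs * r / N) := by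
  haveI : Nonempty (Fin n₁) := ⟨⟨0, h1⟩⟩
  haveI : Nonempty (Fin n₂) := ⟨⟨0, h2⟩⟩
  have hNp : (0 : ℝ) < N := by exact_mod_cast (show 0 < N by omega)
  have hcs0 : 0 ≤ cs := by rw [hcs]; exact le_max_of_le_left (by positivity)
  set S := σ q with hS
  have hS0 : 0 < S := hL.2.2.1 q
  have hpq : S ≤ σ p := hL.2.2.2.1 _ _ (hq p)
  have hκS : σ p = κ * S := by rw [hκ]; field_simp
  have hκ1 : 1 ≤ κ := by rw [hκ]; exact (one_le_div hS0).mpr hpq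
  have hκ0 : 0 < κ := by linarith
  set M : ℝ := μ * cs * r / N with hM
  have hM0 : 0 ≤ M := by positivity
  have hMN : μ * cs * r = M * N := by rw [hM]; field_simp
  have hτM : τ = 4 * (α * N) * M * κ := by
    rw [hτ]; linear_combination 4 * α * κ * hMN
  have hτ0 : 0 ≤ τ := by rw [hτM]; positivity
  set R := Real.sqrt M with hR
  have hR0 : 0 ≤ R := Real.sqrt_nonneg _
  have hsq : Real.sqrt (4 * μ * κ ^ 2 * cs * r / N) = 2 * κ * R := by
    have : 4 * μ * κ ^ 2 * cs * r / N = (2 * κ) ^ 2 * M := by rw [hM]; ring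
    rw [this, Real.sqrt_mul (by positivity), Real.sqrt_sq (by positivity)]
  refine ⟨hsq, ?_⟩
  rw [hsq] at hUk hVk
  set g := γ ^ k with hg
  have hg0 : 0 < g := by positivity
  have hg1 : g ≤ 1 := pow_le_one₀ hγ.le hγ1.le
  set L := hankel hn x with hLdef
  have hLn : ‖L‖ = κ * S := by rw [svd_norm hL p hp, hκS]
  have ht : ‖L - Lk‖ ≤ 2 * τ * g * S := hLL
  have ht' : ‖L - Lk‖ ≤ 2 * τ * S := by
    refine ht.trans ?_
    have : 2 * τ * g * S ≤ 2 * τ * 1 * S := by gcongr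
    linarith
  have hLk_eq : specNorm Lk = ‖Lk‖ := rfl
  have hlo : κ * S * (1 - 2 * τ) ≤ ‖Lk‖ := by
    have a := norm_sub_norm_le L Lk
    rw [hLn] at a
    have : 2 * τ * S * 1 ≤ 2 * τ * S * κ := by gcongr
    nlinarith
  have hup : ‖Lk‖ ≤ κ * S * (1 + 2 * τ) := by
    have a := norm_sub_norm_le Lk L
    rw [hLn, norm_sub_rev] at a
    have : 2 * τ * S * 1 ≤ 2 * τ * S * κ := by gcongr
    nlinarith
  set ζ := β * g * specNorm Lk with hζ
  have hβM : β = M / (2 * κ) := by rw [hβ, hM]; field_simp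
  have hζ1 : M / 2 * g * S * (1 - 2 * τ) ≤ ζ := by
    rw [hζ, hβM, hLk_eq]
    calc M / 2 * g * S * (1 - 2 * τ) = M / (2 * κ) * g * (κ * S * (1 - 2 * τ)) := by field_simp
      _ ≤ _ := by gcongr
  have hζ2 : ζ ≤ M / 2 * g * S * (1 + 2 * τ) := by
    rw [hζ, hβM, hLk_eq]
    calc _ ≤ M / (2 * κ) * g * (κ * S * (1 + 2 * τ)) := by gcongr
      _ = _ := by field_simp
  have hx1 : ∀ t, ‖x t - xk t‖ ≤ M / 2 * g * S * (1 - 2 * τ) := by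
    intro t
    have e : (τ - 2 * τ ^ 2) / (8 * α * κ * N) * g * S = M / 2 * g * S * (1 - 2 * τ) := by
      have : τ - 2 * τ ^ 2 = (4 * (α * N) * M * κ) * (1 - 2 * τ) := by rw [← hτM]; ring
      rw [this]; field_simp; ring
    rw [← e]
    exact (le_ciSup (f := fun t => ‖(x - xk) t‖) (Set.finite_range _).bddAbove t).trans hxx
  set d : Fin N → ℂ := s - hardThreshold ζ (x + s - xk) with hd
  set D := τ * S / (4 * κ) with hD
  have hD0 : 0 ≤ D := by positivity
  have hdsum : ∑ t, ‖d t‖ ≤ D := by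
    refine thr_sum x s xk ζ (M * g * S) D (fun t => (hx1 t).trans hζ1) (fun t => ?_) ?_
    · have := hx1 t
      nlinarith
    · have hs' : ((supp s).card : ℝ) ≤ α * N := hs
      calc ((supp s).card : ℝ) * (M * g * S) ≤ (α * N) * (M * 1 * S) := by gcongr
        _ = D := by rw [hD, hτM]; field_simp
  set E := hankel hn d with hE
  have hrowE : ∀ i, ∑ j, ‖E i j‖ ≤ D := fun i => (hankel_row hn d i).trans hdsum
  have hcolE : ∀ j, ∑ i, ‖E i j‖ ≤ D := fun j => (hankel_col hn d j).trans hdsum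
  have hEn : ‖E‖ ≤ D := schur_test E D hD0 hrowE hcolE
  have hLE : hankel hn (x + s - hardThreshold ζ (x + s - xk)) = L + E := by
    rw [hLdef, hE, hd]
    ext i j
    simp only [hankel, Matrix.of_apply, Matrix.add_apply, Pi.sub_apply, Pi.add_apply]
    ring
  rw [hLE] at hbest
  have hκR0 : 0 ≤ 2 * κ * R := by positivity
  have hop := tangent_op (L := L) (E := E) hLk (2 * τ * S) D ht' hEn
  have hrow := tangent_row (E := E) hL hLk (2 * τ * S) D R (2 * κ * R) (κ * S) hR0 hκR0 ht' hEn
    hLn.le (rowNorm_le hU) (rowNorm_le hUk) (rowNorm_le hVk) hrowE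
  have hcol := tangent_row (E := Eᴴ) (svd_conj hL) (svd_conj hLk) (2 * τ * S) D R (2 * κ * R)
    (κ * S) hR0 hκR0
    (by rw [← Matrix.conjTranspose_sub, Matrix.l2_opNorm_conjTranspose]; exact ht')
    (by rw [Matrix.l2_opNorm_conjTranspose]; exact hEn)
    (by rw [Matrix.l2_opNorm_conjTranspose]; exact hLn.le)
    (rowNorm_le hV) (rowNorm_le hVk) (rowNorm_le hUk)
    (fun j => by simpa [Matrix.conjTranspose_apply] using hcolE j)
  rw [← Matrix.conjTranspose_add, ← tangent_conj] at hcol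
  have hκD : κ * D = τ * S / 4 := by rw [hD]; field_simp
  have hDS : D ≤ τ * S / 4 := by rw [← hκD]; nlinarith
  have hτS : τ * S ≤ S / 12 := by nlinarith
  have hpos : 0 < S - (2 * τ * S + 2 * D) := by nlinarith
  obtain ⟨U1, σ1, V1, hsvd, hu, hv⟩ := svd_of_best _ Lk1 L hbest U σ V hL S (2 * τ * S + 2 * D) _ q hq
    (fun i => hL.2.2.2.1 _ _ (hq i)) hS0.le hop hpos hrow hcol
  have hfin : (R * (κ * S) + (R + 2 * κ * R) * (2 * τ * S) + 2 * (2 * κ * R * D))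
      * (S - (2 * τ * S + 2 * D))⁻¹ ≤ 2 * κ * R := by
    rw [← div_eq_mul_inv, div_le_iff₀ hpos]
    have e1 : R * (κ * S) + (R + 2 * κ * R) * (2 * τ * S) + 2 * (2 * κ * R * D)
        = R * (κ * S + (1 + 2 * κ) * (2 * (τ * S)) + 4 * (κ * D)) := by ring
    have e2 : 2 * κ * R * (S - (2 * τ * S + 2 * D))
        = R * (2 * κ * S - 4 * κ * (τ * S) - 4 * (κ * D)) := by ring
    rw [e1, e2, hκD]
    refine mul_le_mul_of_nonneg_left ?_ hR0
    have h5 : κ * (τ * S) ≤ κ * (S / 12) := by gcongr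
    have h6 : τ * S * 1 ≤ τ * S * κ := by gcongr
    linarith
  exact ⟨U1, σ1, V1, hsvd, le_rowNorm fun i => (hu i).trans hfin, le_rowNorm fun i => (hv i).trans hfin⟩

end helpers

/-- the next iterate `L_{k+1}` is `4μκ²`-incoherent; in particular
its SVD factors satisfy `‖U_{k+1}‖_{2,∞} ≤ 2κ√(μ c_s r/n)`,
`‖V_{k+1}‖_{2,∞} ≤ 2κ√(μ c_s r/n)`. -/
theorem statement16 :
    ∃ c : ℝ, 0 < c ∧
    ∀ (n₁ n₂ n r : ℕ) (hn : n + 1 = n₁ + n₂), 0 < n₁ → 0 < n₂ → (hr : 0 < r) →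
    ∀ (μ α κ cs τ υ β : ℝ), 0 < μ → 0 < α →
    ∀ (x s : Fin n → ℂ)
      (U : Matrix (Fin n₁) (Fin r) ℂ) (σ : Fin r → ℝ) (V : Matrix (Fin n₂) (Fin r) ℂ),
      IsSVD (hankel hn x) U σ V →
      cs = csConst n₁ n₂ n →
      rowNorm U ≤ Real.sqrt (μ * cs * r / n) →
      rowNorm V ≤ Real.sqrt (μ * cs * r / n) →
      κ = σ ⟨0, hr⟩ / σ ⟨r - 1, by omega⟩ →
      IsSparse α s →
      α ≤ c / (μ * cs * r * κ) ^ 2 →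
      τ = 4 * α * μ * cs * r * κ →
      υ = 3 * τ * (2 * Real.sqrt (μ * cs * r) * κ + μ * cs * r * κ) →
      β = μ * cs * r / (2 * κ * n) →
      τ < 1 / 12 →
      υ < 1 - τ →
    ∀ γ : ℝ, 1 / Real.sqrt 12 < γ →
      max (4 * τ + Real.sqrt (1 / 12)) (4 * υ / ((1 - 12 * τ) * (1 - τ - υ) ^ 2)) ≤ γ →
      γ < 1 →
    ∀ (k : ℕ) (Lk : Matrix (Fin n₁) (Fin n₂) ℂ) (xk : Fin n → ℂ)
      (Uk : Matrix (Fin n₁) (Fin r) ℂ) (σk : Fin r → ℝ) (Vk : Matrix (Fin n₂) (Fin r) ℂ),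
      IsSVD Lk Uk σk Vk →
      rowNorm Uk ≤ Real.sqrt (4 * μ * κ ^ 2 * cs * r / n) →
      rowNorm Vk ≤ Real.sqrt (4 * μ * κ ^ 2 * cs * r / n) →
      specNorm (hankel hn x - Lk) ≤ 2 * τ * γ ^ k * σ ⟨r - 1, by omega⟩ →
      vecMaxNorm (x - xk) ≤ (τ - 2 * τ ^ 2) / (8 * α * κ * n) * γ ^ k * σ ⟨r - 1, by omega⟩ →
    ∀ Lk1 : Matrix (Fin n₁) (Fin n₂) ℂ,
      IsBestRankApprox r
        (tangentProj Uk Vk (hankel hn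
          (x + s - hardThreshold (β * γ ^ k * specNorm Lk) (x + s - xk)))) Lk1 →
      IsIncoherent r n (4 * μ * κ ^ 2) cs Lk1 ∧
      ∃ (Uk1 : Matrix (Fin n₁) (Fin r) ℂ) (σk1 : Fin r → ℝ)
        (Vk1 : Matrix (Fin n₂) (Fin r) ℂ),
        IsSVD Lk1 Uk1 σk1 Vk1 ∧
        rowNorm Uk1 ≤ 2 * κ * Real.sqrt (μ * cs * r / n) ∧
        rowNorm Vk1 ≤ 2 * κ * Real.sqrt (μ * cs * r / n) := by
  refine ⟨1, one_pos, ?_⟩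
  intro n₁ n₂ n r hn h1 h2 hr μ α κ cs τ υ β hμ hα x s U σ V hL hcs hU hV hκ hs _ hτ _ hβ hτ1 _
    γ hγ _ hγ1 k Lk xk Uk σk Vk hLk hUk hVk hLL hxx Lk1 hbest
  have hγ0 : 0 < γ := lt_of_le_of_lt (by positivity) hγ
  obtain ⟨hsq, U1, σ1, V1, hsvd, hu, hv⟩ := core hn h1 h2 ⟨0, hr⟩ _
    (fun i => Nat.zero_le _) (fun i => Nat.le_sub_one_of_lt i.2) μ α κ cs τ β hμ hα x s U σ V hL hcs
    hU hV hκ hs hτ hβ hτ1 γ hγ0 hγ1 k Lk xk Uk σk Vk hLk hUk hVk hLL hxx Lk1 hbest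
  exact ⟨⟨U1, σ1, V1, hsvd, by rw [hsq]; exact hu, by rw [hsq]; exact hv⟩, U1, σ1, V1, hsvd, hu, hv⟩

end ASAP
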